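/- Fix weights W_Q, W_K ∈ ℝ^{d_in×d_K}, W_V ∈ ℝ^{d_in×d_V} with d_K even, a feature map φ: ℝ^{d_K} → ℝ^{d_K}, functions D_1: ℝ^{d_K} → ℝ^p and D_2 mapping a matrix Z ∈ ℝ^{L×d_in} and a position i ∈ {1,…,L} to D_2(Z,i) ∈ ℝ^p, an ICL prompt X' ∈ ℝ^{M×d_in}, and biases b_KV ∈ ℝ^{d_K×d_V}, b_D ∈ ℝ^p. Assume the separation property: there exists d* ∈ ℝ^p (depending only on X') such that D_2([X';X], M+i) = d* + D_2(X, i) for all X ∈ ℝ^{N×d_in} and all i ∈ {1,…,N}. Define b'_KV = R_{Θ,−M} b_KV + Σ_{j=1}^{M} R_{Θ,j−M} φ(K'_j) V'^T_j and b'_D = b_D + d*, where K'_j = X'_j W_K and V'_j = X'_j W_V. Then for every X ∈ ℝ^{N×d_in} and every i ∈ {1,…,N}: O_{M+i}([X';X], b_KV, b_D) = O_i(X, b'_KV, b'_D). (Main theorem: exact ICL conversion for masked linearized attention with rotary positional encoding, Theorem 4.5.) -/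

import Mathlib

open Matrix

/-- The rotary (RoPE) matrix `R_{Θ,m} ∈ ℝ^{d×d}` for even `d = 2*h`, angles
`θ : Fin h → ℝ` and shift `m : ℤ`: block-diagonal with `t`-th 2×2 block
`[[cos(mθ_t), −sin(mθ_t)], [sin(mθ_t), cos(mθ_t)]]`. -/
noncomputable def rotary (h : ℕ) (θ : Fin h → ℝ) (m : ℤ) :
    Matrix (Fin (2 * h)) (Fin (2 * h)) ℝ :=
  Matrix.of fun i j =>
    if i.val / 2 = j.val / 2 then
      if i.val % 2 = 0 then
        if j.val % 2 = 0 then Real.cos ((m : ℝ) * θ ⟨i.val / 2, by have := i.isLt; omega⟩)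
        else -Real.sin ((m : ℝ) * θ ⟨i.val / 2, by have := i.isLt; omega⟩)
      else
        if j.val % 2 = 0 then Real.sin ((m : ℝ) * θ ⟨i.val / 2, by have := i.isLt; omega⟩)
        else Real.cos ((m : ℝ) * θ ⟨i.val / 2, by have := i.isLt; omega⟩)
    else 0

/-- Vertical concatenation `[A; B]` of token matrices (tokens are rows). -/
def vcat {M N d : ℕ} (A : Matrix (Fin M) (Fin d) ℝ) (B : Matrix (Fin N) (Fin d) ℝ) :
    Matrix (Fin (M + N)) (Fin d) ℝ :=
  Matrix.of (Fin.append A B)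

/-- The rotary-encoded Key-Value matrix of input `Z` up to position `i` (1-indexed
position `i.val + 1`): `Σ_{j=1}^{i} R_{Θ,j} φ(K_j) V_jᵀ` where `K_j = Z_j W_K`,
`V_j = Z_j W_V`. -/
noncomputable def kvSum {L din dV h : ℕ} (θ : Fin h → ℝ)
    (WK : Matrix (Fin din) (Fin (2 * h)) ℝ) (WV : Matrix (Fin din) (Fin dV) ℝ)
    (φ : (Fin (2 * h) → ℝ) → (Fin (2 * h) → ℝ))
    (Z : Matrix (Fin L) (Fin din) ℝ) (i : Fin L) : Matrix (Fin (2 * h)) (Fin dV) ℝ :=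
  ∑ j ∈ Finset.Iic i,
    Matrix.vecMulVec ((rotary h θ (j.val + 1)).mulVec (φ (Matrix.vecMul (Z j) WK)))
      (Matrix.vecMul (Z j) WV)

/-- Masked linearized attention with rotary positional encoding and bias terms:
`O_i(Z, b_KV, b_D)ᵀ = (R_{Θ,i} φ(Q_i))ᵀ (Σ_{j=1}^{i} R_{Θ,j} φ(K_j) V_jᵀ + b_KV)
  / (D_1(Q_i)ᵀ (D_2(Z,i) + b_D))`. -/
noncomputable def attnOut {L din dV p h : ℕ} (θ : Fin h → ℝ)
    (WQ WK : Matrix (Fin din) (Fin (2 * h)) ℝ) (WV : Matrix (Fin din) (Fin dV) ℝ)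
    (φ : (Fin (2 * h) → ℝ) → (Fin (2 * h) → ℝ))
    (D1 : (Fin (2 * h) → ℝ) → (Fin p → ℝ))
    (D2 : Matrix (Fin L) (Fin din) ℝ → Fin L → (Fin p → ℝ))
    (Z : Matrix (Fin L) (Fin din) ℝ)
    (bKV : Matrix (Fin (2 * h)) (Fin dV) ℝ) (bD : Fin p → ℝ) (i : Fin L) :
    Fin dV → ℝ :=
  fun v =>
    Matrix.vecMul ((rotary h θ (i.val + 1)).mulVec (φ (Matrix.vecMul (Z i) WQ)))
      (kvSum θ WK WV φ Z i + bKV) v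
    / (D1 (Matrix.vecMul (Z i) WQ) ⬝ᵥ (D2 Z i + bD))

/-- Rotary matrices compose by adding their shifts. -/
lemma rotary_mul_rotary (h : ℕ) (θ : Fin h → ℝ) (m n : ℤ) :
    rotary h θ m * rotary h θ n = rotary h θ (m + n) := by
  ext i j
  have hi := i.isLt
  rw [Matrix.mul_apply, Finset.sum_eq_add (⟨2 * (i.val / 2), by omega⟩ : Fin (2 * h))
    ⟨2 * (i.val / 2) + 1, by omega⟩ (by simp) ?_ (by simp) (by simp)]
  · have hdiv (t : ℕ) : (2 * t + 1) / 2 = t := by omega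
    by_cases hij : i.val / 2 = j.val / 2
    · rcases Nat.mod_two_eq_zero_or_one i.val with h0 | h0 <;>
        rcases Nat.mod_two_eq_zero_or_one j.val with h1 | h1 <;>
        simp [rotary, hdiv, h0, h1, hij, add_mul, Real.cos_add, Real.sin_add] <;> ring
    · simp [rotary, hdiv, hij]
  · rintro k - ⟨hk0, hk1⟩
    have hik : i.val / 2 ≠ k.val / 2 := by
      simp only [ne_eq, Fin.ext_iff] at hk0 hk1
      omega
    simp [rotary, hik]

/-- The transpose of a rotary matrix is the rotary matrix of the opposite shift. -/
lemma transpose_rotary (h : ℕ) (θ : Fin h → ℝ) (m : ℤ) :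
    (rotary h θ m)ᵀ = rotary h θ (-m) := by
  ext i j
  by_cases hij : i.val / 2 = j.val / 2
  · rcases Nat.mod_two_eq_zero_or_one i.val with h0 | h0 <;>
      rcases Nat.mod_two_eq_zero_or_one j.val with h1 | h1 <;>
      simp [rotary, h0, h1, hij]
  · simp [rotary, hij, Ne.symm hij]

/-- A shift of the query by `m` can be moved onto the matrix it is multiplied with. -/
lemma rotary_add_mulVec_vecMul {h d : ℕ} (θ : Fin h → ℝ) (m n : ℤ) (q : Fin (2 * h) → ℝ)
    (A : Matrix (Fin (2 * h)) (Fin d) ℝ) :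
    (rotary h θ (m + n) *ᵥ q) ᵥ* A = (rotary h θ n *ᵥ q) ᵥ* (rotary h θ (-m) * A) := by
  rw [← rotary_mul_rotary, ← Matrix.mulVec_mulVec, ← Matrix.vecMul_transpose (rotary h θ m),
    transpose_rotary, Matrix.vecMul_vecMul]

lemma rotary_mul_vecMulVec {h d : ℕ} (θ : Fin h → ℝ) (m n : ℤ) (k : Fin (2 * h) → ℝ)
    (v : Fin d → ℝ) :
    rotary h θ m * Matrix.vecMulVec (rotary h θ n *ᵥ k) v
      = Matrix.vecMulVec (rotary h θ (m + n) *ᵥ k) v := by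
  rw [Matrix.mul_vecMulVec, Matrix.mulVec_mulVec, rotary_mul_rotary]

lemma vcat_castAdd {M N d : ℕ} (A : Matrix (Fin M) (Fin d) ℝ) (B : Matrix (Fin N) (Fin d) ℝ)
    (j : Fin M) : vcat A B (Fin.castAdd N j) = A j :=
  Fin.append_left A B j

lemma vcat_natAdd {M N d : ℕ} (A : Matrix (Fin M) (Fin d) ℝ) (B : Matrix (Fin N) (Fin d) ℝ)
    (j : Fin N) : vcat A B (Fin.natAdd M j) = B j :=
  Fin.append_right A B j

/-- A prefix sum over `Fin (M + N)` reaching into the second block splits into the whole first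
block and a prefix sum over the second. -/
lemma sum_Iic_natAdd {α : Type*} [AddCommMonoid α] {M N : ℕ} (f : Fin (M + N) → α) (i : Fin N) :
    ∑ j ∈ Finset.Iic (Fin.natAdd M i), f j
      = ∑ j : Fin M, f (Fin.castAdd N j) + ∑ j ∈ Finset.Iic i, f (Fin.natAdd M j) := by
  have hle (j : Fin M) : Fin.castAdd N j ≤ Fin.natAdd M i := by
    simp only [Fin.le_def, Fin.val_castAdd, Fin.val_natAdd]
    omega
  have hfilter {K : ℕ} (a : Fin K) : Finset.Iic a = Finset.univ.filter (· ≤ a) := by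
    ext
    simp
  rw [hfilter, hfilter, Finset.sum_filter, Finset.sum_filter, Fin.sum_univ_add]
  simp [hle]

/-- Undoing the shift of a concatenated input splits its Key-Value matrix into the contribution
of the prompt and the Key-Value matrix of the remaining input. -/
lemma rotary_neg_mul_kvSum_vcat {din dV h M N : ℕ} (θ : Fin h → ℝ)
    (WK : Matrix (Fin din) (Fin (2 * h)) ℝ) (WV : Matrix (Fin din) (Fin dV) ℝ)
    (φ : (Fin (2 * h) → ℝ) → (Fin (2 * h) → ℝ))
    (X' : Matrix (Fin M) (Fin din) ℝ) (X : Matrix (Fin N) (Fin din) ℝ) (i : Fin N) :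
    rotary h θ (-(M : ℤ)) * kvSum θ WK WV φ (vcat X' X) (Fin.natAdd M i)
      = ∑ j : Fin M,
          Matrix.vecMulVec
            ((rotary h θ ((j.val + 1 : ℤ) - M)).mulVec (φ (Matrix.vecMul (X' j) WK)))
            (Matrix.vecMul (X' j) WV)
        + kvSum θ WK WV φ X i := by
  rw [kvSum, sum_Iic_natAdd, Matrix.mul_add, Matrix.mul_sum, Matrix.mul_sum, kvSum]
  simp only [rotary_mul_vecMulVec, vcat_castAdd, vcat_natAdd, Fin.val_castAdd, Fin.val_natAdd,
    Nat.cast_add, neg_add_eq_sub, add_assoc, add_sub_cancel_left]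

/-- **Exact ICL conversion for masked linearized attention with RoPE**
(Theorem 4.5): under the separation property of the normalizing factor `D_2`, the
output at position `M+i` of the concatenated input `[X'; X]` with biases
`b_KV, b_D` equals the output at position `i` of the input `X` alone with the
converted biases
`b'_KV = R_{Θ,−M} b_KV + Σ_{j=1}^{M} R_{Θ,j−M} φ(K'_j) V'_jᵀ` and
`b'_D = b_D + d*`. -/
theorem icl_conversion_linearized_attention {din dV p h M N : ℕ}
    (θ : Fin h → ℝ)
    (WQ WK : Matrix (Fin din) (Fin (2 * h)) ℝ) (WV : Matrix (Fin din) (Fin dV) ℝ)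
    (φ : (Fin (2 * h) → ℝ) → (Fin (2 * h) → ℝ))
    (D1 : (Fin (2 * h) → ℝ) → (Fin p → ℝ))
    (D2 : ∀ {L : ℕ}, Matrix (Fin L) (Fin din) ℝ → Fin L → (Fin p → ℝ))
    (X' : Matrix (Fin M) (Fin din) ℝ)
    (bKV : Matrix (Fin (2 * h)) (Fin dV) ℝ) (bD : Fin p → ℝ)
    (dstar : Fin p → ℝ)
    (hsep : ∀ (X : Matrix (Fin N) (Fin din) ℝ) (i : Fin N),
      D2 (vcat X' X) (Fin.natAdd M i) = dstar + D2 X i)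
    (bKV' : Matrix (Fin (2 * h)) (Fin dV) ℝ)
    (hbKV' : bKV' = rotary h θ (-(M : ℤ)) * bKV
      + ∑ j : Fin M,
          Matrix.vecMulVec
            ((rotary h θ ((j.val + 1 : ℤ) - M)).mulVec (φ (Matrix.vecMul (X' j) WK)))
            (Matrix.vecMul (X' j) WV))
    (bD' : Fin p → ℝ) (hbD' : bD' = bD + dstar)
    (X : Matrix (Fin N) (Fin din) ℝ) (i : Fin N) :
    attnOut θ WQ WK WV φ D1 D2 (vcat X' X) bKV bD (Fin.natAdd M i)
      = attnOut θ WQ WK WV φ D1 D2 X bKV' bD' i := by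
  have hshift : ((Fin.natAdd M i).val : ℤ) + 1 = M + (i.val + 1) := by
    rw [Fin.val_natAdd, Nat.cast_add, add_assoc]
  have hKV : rotary h θ (-(M : ℤ)) * (kvSum θ WK WV φ (vcat X' X) (Fin.natAdd M i) + bKV)
      = kvSum θ WK WV φ X i + bKV' := by
    rw [hbKV', Matrix.mul_add, rotary_neg_mul_kvSum_vcat]
    abel
  have hD : D2 (vcat X' X) (Fin.natAdd M i) + bD = D2 X i + bD' := by
    rw [hbD', hsep]
    abel
  funext v
  rw [attnOut, attnOut, vcat_natAdd, hshift, rotary_add_mulVec_vecMul, hKV, hD]
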